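/- Every simple logic program without constraints has at least one extended answer set. -/

import Mathlib

namespace ASP

/-- A literal is an atom `a` or a negated atom `¬ a`. -/
inductive Lit (α : Type) : Type where
  | pos (a : α)
  | neg (a : α)
deriving DecidableEq

/-- Classical negation of a literal. -/
def Lit.negate {α : Type} : Lit α → Lit α
  | .pos a => .neg a
  | .neg a => .pos a

/-- The atom underlying a literal. -/
def Lit.atom {α : Type} : Lit α → α
  | .pos a => a
  | .neg a => a

/-- A rule of a simple logic program: a head which is a literal or absent
(a constraint), and a finite set of literals as body. -/
structure Rule (α : Type) [DecidableEq α] : Type where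
  head : Option (Lit α)
  body : Finset (Lit α)

variable {α : Type} [DecidableEq α]

/-- A set of literals is consistent if it contains no complementary pair. -/
def Consistent (I : Set (Lit α)) : Prop :=
  ∀ a : α, ¬(Lit.pos a ∈ I ∧ Lit.neg a ∈ I)

/-- The Herbrand base of a program: all atoms occurring in it. -/
def herbrand (P : Set (Rule α)) : Set α :=
  {a | ∃ r ∈ P, (∃ l, r.head = some l ∧ l.atom = a) ∨ (∃ l ∈ r.body, l.atom = a)}

/-- An interpretation of `P`: a consistent set of literals over the Herbrand base of `P`. -/
def IsInterp (P : Set (Rule α)) (I : Set (Lit α)) : Prop :=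
  Consistent I ∧ ∀ l ∈ I, l.atom ∈ herbrand P

/-- A rule `a ← β` is satisfied by `I` if `a ∈ I` whenever `β ⊆ I`;
a constraint `← β` is satisfied if its body is not contained in `I`. -/
def Satisfied (I : Set (Lit α)) (r : Rule α) : Prop :=
  ↑r.body ⊆ I → ∃ l, r.head = some l ∧ l ∈ I

/-- A rule is applied w.r.t. `I` if its body holds and its head literal is in `I`. -/
def Applied (I : Set (Lit α)) (r : Rule α) : Prop :=
  ↑r.body ⊆ I ∧ ∃ l, r.head = some l ∧ l ∈ I

/-- A rule `a ← β` is defeated w.r.t. `P` and `I` iff `P` contains an applied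
competing rule `¬a ← β'`. -/
def Defeated (P : Set (Rule α)) (I : Set (Lit α)) (r : Rule α) : Prop :=
  ∃ l, r.head = some l ∧ ∃ r' ∈ P, r'.head = some l.negate ∧ Applied I r'

/-- The reduct of `P` w.r.t. `I`: the rules of `P` satisfied by `I`. -/
def reduct (P : Set (Rule α)) (I : Set (Lit α)) : Set (Rule α) :=
  {r ∈ P | Satisfied I r}

/-- `star R` is the unique minimal model of `R` viewed as a positive program
(negative literals treated as fresh atoms; constraints never fire their head). -/
def star (R : Set (Rule α)) : Set (Lit α) :=
  ⋂₀ {J : Set (Lit α) | ∀ r ∈ R, ↑r.body ⊆ J → ∀ l, r.head = some l → l ∈ J}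

/-- An interpretation is founded iff `(P_I)* = I`. -/
def Founded (P : Set (Rule α)) (I : Set (Lit α)) : Prop :=
  star (reduct P I) = I

/-- A founded interpretation `M` is an extended answer set of `P` iff every rule
of `P` is satisfied or defeated w.r.t. `M`. -/
def ExtAnswerSet (P : Set (Rule α)) (M : Set (Lit α)) : Prop :=
  IsInterp P M ∧ Founded P M ∧ ∀ r ∈ P, Satisfied M r ∨ Defeated P M r

/-- An answer set of a program without negation as failure: a minimal
interpretation satisfying all rules of the program. -/
def IsAnswerSet (P : Set (Rule α)) (M : Set (Lit α)) : Prop :=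
  IsInterp P M ∧ (∀ r ∈ P, Satisfied M r) ∧
    ∀ J, IsInterp P J → (∀ r ∈ P, Satisfied J r) → ¬J ⊂ M


/-- The rules of `P` that are applied w.r.t. `I`. -/
def appliedRules (P : Set (Rule α)) (I : Set (Lit α)) : Set (Rule α) :=
  {r ∈ P | Applied I r}

theorem star_mono {R S : Set (Rule α)} (h : R ⊆ S) : star R ⊆ star S :=
  Set.sInter_subset_sInter fun _ hJ r hr => hJ r (h hr)

theorem star_subset {R : Set (Rule α)} {J : Set (Lit α)}
    (hJ : ∀ r ∈ R, ↑r.body ⊆ J → ∀ l, r.head = some l → l ∈ J) : star R ⊆ J :=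
  Set.sInter_subset_of_mem hJ

theorem mem_star_of_rule {R : Set (Rule α)} {r : Rule α} (hr : r ∈ R)
    (hb : ↑r.body ⊆ star R) {l : Lit α} (hl : r.head = some l) : l ∈ star R :=
  Set.mem_sInter.2 fun J hJ => hJ r hr (hb.trans (Set.sInter_subset_of_mem hJ)) l hl

theorem exists_rule_of_mem_star {R : Set (Rule α)} {l : Lit α} (hl : l ∈ star R) :
    ∃ r ∈ R, r.head = some l :=
  star_subset (J := {l | ∃ r ∈ R, r.head = some l}) (fun r hr _ _ h => ⟨r, hr, h⟩) hl

theorem Applied.mono {I J : Set (Lit α)} {r : Rule α} (h : Applied I r) (hIJ : I ⊆ J) :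
    Applied J r :=
  ⟨h.1.trans hIJ, h.2.imp fun _ hl => ⟨hl.1, hIJ hl.2⟩⟩

theorem appliedRules_mono (P : Set (Rule α)) {I J : Set (Lit α)} (h : I ⊆ J) :
    appliedRules P I ⊆ appliedRules P J :=
  fun _ hr => ⟨hr.1, hr.2.mono h⟩

/-- If every literal of `I` is derivable from the rules applied w.r.t. `I`, then `I` is founded. -/
theorem founded_of_subset_star {P : Set (Rule α)} {I : Set (Lit α)}
    (h : I ⊆ star (appliedRules P I)) : Founded P I := by
  refine (star_subset ?_).antisymm (h.trans (star_mono ?_))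
  · rintro r ⟨-, hr⟩ hb l hl
    obtain ⟨l', hl', hmem⟩ := hr hb
    rw [hl] at hl'
    exact Option.some.inj hl' ▸ hmem
  · exact fun r hr => ⟨hr.1, fun _ => hr.2.2⟩

theorem Consistent.insert {I : Set (Lit α)} (hI : Consistent I) {l : Lit α}
    (hl : l.negate ∉ I) : Consistent (insert l I) := by
  intro a
  have := hI a
  cases l <;> simp only [Lit.negate] at hl <;> simp only [Set.mem_insert_iff] <;> grind

theorem Consistent.sUnion {c : Set (Set (Lit α))} (hc : IsChain (· ⊆ ·) c)
    (h : ∀ I ∈ c, Consistent I) : Consistent (⋃₀ c) := by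
  rintro a ⟨⟨I, hI, haI⟩, J, hJ, haJ⟩
  rcases hc.total hI hJ with hIJ | hJI
  · exact h J hJ a ⟨hIJ haI, haJ⟩
  · exact h I hI a ⟨haI, hJI haJ⟩

theorem exists_maximal_supported (P : Set (Rule α)) :
    ∃ M : Set (Lit α), Maximal (fun I => Consistent I ∧ I ⊆ star (appliedRules P I)) M := by
  refine zorn_subset {I | Consistent I ∧ I ⊆ star (appliedRules P I)} fun c hc hchain =>
    ⟨⋃₀ c, ⟨.sUnion hchain fun I hI => (hc hI).1, ?_⟩, fun I hI => Set.subset_sUnion_of_mem hI⟩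
  exact Set.sUnion_subset fun I hI =>
    (hc hI).2.trans (star_mono (appliedRules_mono P (Set.subset_sUnion_of_mem hI)))

/-- Every simple logic program without constraints has at least
one extended answer set. -/
theorem exists_extAnswerSet_of_no_constraints
    {α : Type} [DecidableEq α] (P : Set (Rule α)) (hP : P.Countable)
    (hNoConstraints : ∀ r ∈ P, r.head ≠ none) :
    ∃ M : Set (Lit α), ExtAnswerSet P M := by
  obtain ⟨M, ⟨hcons, hsupp⟩, hmax⟩ := exists_maximal_supported P
  refine ⟨M, ⟨hcons, fun l hl => ?_⟩, founded_of_subset_star hsupp, fun r hr => ?_⟩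
  · obtain ⟨r, hr, hrl⟩ := exists_rule_of_mem_star (hsupp hl)
    exact ⟨r, hr.1, Or.inl ⟨l, hrl, rfl⟩⟩
  obtain ⟨l, hl⟩ := Option.ne_none_iff_exists'.1 (hNoConstraints r hr)
  by_cases hneg : l.negate ∈ M
  · obtain ⟨r', hr', hrl'⟩ := exists_rule_of_mem_star (hsupp hneg)
    exact Or.inr ⟨l, hl, r', hr'.1, hrl', hr'.2⟩
  refine Or.inl fun hb => ⟨l, hl, ?_⟩
  have hM : M ⊆ insert l M := Set.subset_insert l M
  have hM' : M ⊆ star (appliedRules P (insert l M)) :=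
    hsupp.trans (star_mono (appliedRules_mono P hM))
  have hr' : r ∈ appliedRules P (insert l M) :=
    ⟨hr, hb.trans hM, l, hl, Set.mem_insert l M⟩
  exact hmax ⟨hcons.insert hneg,
    Set.insert_subset (mem_star_of_rule hr' (hb.trans hM') hl) hM'⟩ hM (Set.mem_insert l M)

end ASP
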